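/- Let n ≥ 3, V ∈ RH_{n/2} with critical radius function ρ, and let N₀ ≥ 1 be the constant in the two-sided comparison estimate c₀^{-1}ρ(x)(1+|x−y|/ρ(x))^{−N₀} ≤ ρ(y) ≤ c₀ρ(x)(1+|x−y|/ρ(x))^{N₀/(N₀+1)}. Let θ > 0 and b ∈ BMO_L^θ, and set θ' = (N₀+1)θ. Then there is a constant C such that for every ball B = B(x₀, r) and every integer k ≥ 1: (1/|2^k B|) ∫_{2^k B} |b(y) − b_B| dy ≤ C ‖b‖_θ k (1 + 2^k r/ρ(x₀))^{θ'}. -/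

import Mathlib

open MeasureTheory Metric Set
open scoped ENNReal

noncomputable section

/-- Euclidean space `ℝⁿ`. -/
abbrev Eucl (n : ℕ) := EuclideanSpace ℝ (Fin n)

namespace SchrodingerCommutators

variable {n : ℕ}

/-- The average `(1/|B(x,r)|) ∫_{B(x,r)} f` of a function over a ball. -/
def ballAvg (f : Eucl n → ℝ) (x : Eucl n) (r : ℝ) : ℝ :=
  (volume (ball x r)).toReal⁻¹ * ∫ y in ball x r, f y

/-- `V` is a nonnegative locally integrable function in the reverse Hölder class `RH_q`:
`((1/|B|)∫_B V^q)^{1/q} ≤ (C/|B|) ∫_B V` for all balls `B`. -/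
def IsRH (V : Eucl n → ℝ) (q : ℝ) : Prop :=
  (∀ x, 0 ≤ V x) ∧ LocallyIntegrable V volume ∧
    ∃ C > 0, ∀ (x : Eucl n) (r : ℝ), 0 < r →
      (ballAvg (fun y => V y ^ q) x r) ^ (1 / q) ≤ C * ballAvg V x r

/-- The critical radius function `ρ(x) = sup {r > 0 : r^{2-n} ∫_{B(x,r)} V ≤ 1}`. -/
def critRad (V : Eucl n → ℝ) (x : Eucl n) : ℝ :=
  sSup {r : ℝ | 0 < r ∧ r ^ (2 - (n : ℝ)) * ∫ y in ball x r, V y ≤ 1}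

/-- The `A_p^{L,θ}` condition for a weight `w`, relative to a critical radius function `ρ`:
`(∫_B w)^{1/p} (∫_B w^{-1/(p-1)})^{1/p'} ≤ C |B| (1 + r/ρ(x))^θ` for all balls `B = B(x,r)`. -/
def MemApLtheta (ρ : Eucl n → ℝ) (w : Eucl n → ℝ) (p θ : ℝ) : Prop :=
  ∃ C > 0, ∀ (x : Eucl n) (r : ℝ), 0 < r →
    (∫ y in ball x r, w y) ^ (1 / p) *
        (∫ y in ball x r, w y ^ (-(1 / (p - 1)))) ^ (1 - 1 / p)
      ≤ C * (volume (ball x r)).toReal * (1 + r / ρ x) ^ θ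

/-- `w ∈ A_p^L = ∪_{θ>0} A_p^{L,θ}`. -/
def MemApL (ρ : Eucl n → ℝ) (w : Eucl n → ℝ) (p : ℝ) : Prop :=
  ∃ θ > 0, MemApLtheta ρ w p θ

/-- The conjugate exponent `r' = r/(r-1)`. -/
def conjExp (r : ℝ) : ℝ := r / (r - 1)

/-- `b` satisfies the `BMO_L^θ` bound with constant `C`:
`(1/|B|) ∫_B |b - b_B| ≤ C (1 + r/ρ(x))^θ` for all balls `B = B(x,r)`. -/
def BMOLBound (ρ : Eucl n → ℝ) (b : Eucl n → ℝ) (θ C : ℝ) : Prop :=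
  ∀ (x : Eucl n) (r : ℝ), 0 < r →
    (volume (ball x r)).toReal⁻¹ * (∫ y in ball x r, |b y - ballAvg b x r|)
      ≤ C * (1 + r / ρ x) ^ θ

/-- `b ∈ BMO_L^θ`: `b` is locally integrable and satisfies the `BMO_L^θ` bound
for some finite constant. -/
def MemBMOL (ρ : Eucl n → ℝ) (b : Eucl n → ℝ) (θ : ℝ) : Prop :=
  LocallyIntegrable b volume ∧ ∃ C ≥ 0, BMOLBound ρ b θ C

/-- `‖b‖_θ`: the least constant in the `BMO_L^θ` bound. -/
def bmoLNorm (ρ : Eucl n → ℝ) (b : Eucl n → ℝ) (θ : ℝ) : ℝ :=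
  sInf {C : ℝ | 0 ≤ C ∧ BMOLBound ρ b θ C}

/-- The local maximal function `M_{ρ,α} g(x) = sup_{x ∈ B(y,r), r ≤ αρ(y)} (1/|B|)∫_B |g|`. -/
def MrhoLoc (ρ : Eucl n → ℝ) (α : ℝ) (g : Eucl n → ℝ) (x : Eucl n) : ℝ :=
  sSup {m : ℝ | ∃ (y : Eucl n) (r : ℝ), 0 < r ∧ r ≤ α * ρ y ∧ x ∈ ball y r ∧
    m = ballAvg (fun z => |g z|) y r}

/-- The local sharp maximal function
`M^♯_{ρ,α} g(x) = sup_{x ∈ B(y,r), r ≤ αρ(y)} (1/|B|)∫_B |g - g_B|`. -/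
def MrhoSharp (ρ : Eucl n → ℝ) (α : ℝ) (g : Eucl n → ℝ) (x : Eucl n) : ℝ :=
  sSup {m : ℝ | ∃ (y : Eucl n) (r : ℝ), 0 < r ∧ r ≤ α * ρ y ∧ x ∈ ball y r ∧
    m = ballAvg (fun z => |g z - ballAvg g y r|) y r}

/-- A covering family of critical balls `Q_j = B(x_j, ρ(x_j))`: the balls cover `ℝⁿ`
and the dilates `σQ_j` have finite overlap `Σ_j χ_{σQ_j} ≤ C σ^{N₁}` for every `σ ≥ 1`. -/
def IsCriticalCovering (V : Eucl n → ℝ) (c : ℕ → Eucl n) : Prop :=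
  (⋃ k, ball (c k) (critRad V (c k))) = univ ∧
    ∀ σ : ℝ, 1 ≤ σ → ∃ C > 0, ∃ N₁ : ℝ, ∀ x : Eucl n,
      (∑' k : ℕ, (ball (c k) (σ * critRad V (c k))).indicator (fun _ => (1 : ℝ≥0∞)) x)
        ≤ ENNReal.ofReal (C * σ ^ N₁)

/-- The operator `G_{κ,α,s}` (with decay parameter `N`):
`G f(x) = sup_{Q ∋ x critical} Σ_k 2^{-Nk} (|2^k κQ|^{αs/n - 1} ∫_{2^k κQ} |f|^s)^{1/s}`. -/
def Gop (V : Eucl n → ℝ) (κ α s N : ℝ) (f : Eucl n → ℝ) (x : Eucl n) : ℝ :=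
  sSup {m : ℝ | ∃ y : Eucl n, x ∈ ball y (critRad V y) ∧
    m = ∑' k : ℕ, (2 : ℝ) ^ (-(N * (k : ℝ))) *
      ((volume (ball y (2 ^ k * κ * critRad V y))).toReal ^ (α * s / (n : ℝ) - 1) *
        ∫ z in ball y (2 ^ k * κ * critRad V y), |f z| ^ s) ^ (1 / s)}

/-- The operator `H_{κ,s}` (with decay parameter `N`):
`H f(x) = sup_{Q ∋ x critical} Σ_k 2^{-Nk} (|2^k κQ|⁻¹ ∫_{2^k κQ} |f|^s)^{1/s}`. -/
def Hop (V : Eucl n → ℝ) (κ s N : ℝ) (f : Eucl n → ℝ) (x : Eucl n) : ℝ :=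
  sSup {m : ℝ | ∃ y : Eucl n, x ∈ ball y (critRad V y) ∧
    m = ∑' k : ℕ, (2 : ℝ) ^ (-(N * (k : ℝ))) *
      ((volume (ball y (2 ^ k * κ * critRad V y))).toReal⁻¹ *
        ∫ z in ball y (2 ^ k * κ * critRad V y), |f z| ^ s) ^ (1 / s)}

/-- The fractional maximal function
`M_{α,s} f(x) = sup_{B ∋ x} (|B|^{sα/n - 1} ∫_B |f|^s)^{1/s}`. -/
def Mfrac (α s : ℝ) (f : Eucl n → ℝ) (x : Eucl n) : ℝ :=
  sSup {m : ℝ | ∃ (y : Eucl n) (r : ℝ), 0 < r ∧ x ∈ ball y r ∧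
    m = ((volume (ball y r)).toReal ^ (s * α / (n : ℝ) - 1) *
      ∫ z in ball y r, |f z| ^ s) ^ (1 / s)}

/-- The localized fractional maximal operator
`M̃_{α,s} f = Σ_k χ_{Q_k} M_{α,s}(f χ_{κ'Q_k})` attached to a covering family of
critical balls `Q_k = B(c_k, ρ(c_k))` with dilates `κ'Q_k`. -/
def Mtilde (V : Eucl n → ℝ) (c : ℕ → Eucl n) (κ' α s : ℝ) (f : Eucl n → ℝ)
    (x : Eucl n) : ℝ :=
  ∑' k : ℕ, (ball (c k) (critRad V (c k))).indicator
    (fun x' => Mfrac α s ((ball (c k) (κ' * critRad V (c k))).indicator f) x') x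

/-- The weighted measure `w dx`. -/
def wMeasure (w : Eucl n → ℝ) : Measure (Eucl n) :=
  volume.withDensity fun x => ENNReal.ofReal (w x)

end SchrodingerCommutators
open SchrodingerCommutators

namespace SchrodingerCommutators

theorem integrableOn_ball {n : ℕ} {b : Eucl n → ℝ} (hb : LocallyIntegrable b volume)
    (x : Eucl n) (r : ℝ) : IntegrableOn b (ball x r) volume :=
  (hb.integrableOn_isCompact (isCompact_closedBall x r)).mono_set ball_subset_closedBall

theorem volume_ball_toReal_pos {n : ℕ} (x : Eucl n) {r : ℝ} (hr : 0 < r) :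
    0 < (volume (ball x r)).toReal :=
  ENNReal.toReal_pos (measure_ball_pos volume x hr).ne' measure_ball_lt_top.ne

theorem volume_ball_two_mul_toReal {n : ℕ} (x : Eucl n) (r : ℝ) :
    (volume (ball x (2 * r))).toReal = 2 ^ n * (volume (ball x r)).toReal := by
  rw [Measure.addHaar_ball_mul_of_pos volume x two_pos, Measure.addHaar_ball_center volume x r]
  simp

theorem critRad_nonneg {n : ℕ} (V : Eucl n → ℝ) (x : Eucl n) : 0 ≤ critRad V x :=
  Real.sSup_nonneg fun _ hr => hr.1.le

theorem integrableOn_abs_sub_const {n : ℕ} {b : Eucl n → ℝ} (hb : LocallyIntegrable b volume)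
    (x : Eucl n) (r c : ℝ) : IntegrableOn (fun y => |b y - c|) (ball x r) volume :=
  ((integrableOn_ball hb x r).sub (integrableOn_const measure_ball_lt_top.ne)).abs

/-- The mean oscillation around any constant dominates the distance of the average to it. -/
theorem abs_ballAvg_sub_le {n : ℕ} {b : Eucl n → ℝ} (hb : LocallyIntegrable b volume)
    (x : Eucl n) {r : ℝ} (hr : 0 < r) (c : ℝ) :
    |ballAvg b x r - c| ≤
      (volume (ball x r)).toReal⁻¹ * ∫ y in ball x r, |b y - c| := by
  have hv := volume_ball_toReal_pos x hr
  have hI : ballAvg b x r - c =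
      (volume (ball x r)).toReal⁻¹ * ∫ y in ball x r, (b y - c) := by
    rw [integral_sub (integrableOn_ball hb x r) (integrableOn_const measure_ball_lt_top.ne),
      setIntegral_const, ballAvg, measureReal_def, smul_eq_mul]
    field_simp
  rw [hI, abs_mul, abs_of_pos (inv_pos.2 hv)]
  gcongr
  exact abs_integral_le_integral_abs

/-- Replacing the average by another constant changes the mean oscillation by at most the
distance between the two. -/
theorem ballAvg_abs_sub_le {n : ℕ} {b : Eucl n → ℝ} (hb : LocallyIntegrable b volume)
    (x : Eucl n) {r : ℝ} (hr : 0 < r) (a c : ℝ) :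
    (volume (ball x r)).toReal⁻¹ * (∫ y in ball x r, |b y - c|) ≤
      (volume (ball x r)).toReal⁻¹ * (∫ y in ball x r, |b y - a|) + |a - c| := by
  have hv := volume_ball_toReal_pos x hr
  have hI : (∫ y in ball x r, |b y - c|) ≤
      (∫ y in ball x r, |b y - a|) + (volume (ball x r)).toReal * |a - c| := by
    rw [← smul_eq_mul, ← measureReal_def, ← setIntegral_const, ← integral_add
      (integrableOn_abs_sub_const hb x r a) (integrableOn_const measure_ball_lt_top.ne)]
    exact integral_mono (integrableOn_abs_sub_const hb x r c)
      ((integrableOn_abs_sub_const hb x r a).add (integrableOn_const measure_ball_lt_top.ne))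
      fun y => abs_sub_le _ _ _
  calc _ ≤ (volume (ball x r)).toReal⁻¹ *
        ((∫ y in ball x r, |b y - a|) + (volume (ball x r)).toReal * |a - c|) := by gcongr
    _ = _ := by field_simp

/-- Averages over a ball and its double differ by at most `2 ^ n` times the mean oscillation
on the double. -/
theorem abs_ballAvg_two_mul_sub_le {n : ℕ} {b : Eucl n → ℝ} (hb : LocallyIntegrable b volume)
    (x : Eucl n) {r : ℝ} (hr : 0 < r) :
    |ballAvg b x (2 * r) - ballAvg b x r| ≤
      2 ^ n * ((volume (ball x (2 * r))).toReal⁻¹ *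
        ∫ y in ball x (2 * r), |b y - ballAvg b x (2 * r)|) := by
  have hv := volume_ball_toReal_pos x hr
  rw [abs_sub_comm]
  refine (abs_ballAvg_sub_le hb x hr _).trans ?_
  calc _ ≤ (volume (ball x r)).toReal⁻¹ *
        ∫ y in ball x (2 * r), |b y - ballAvg b x (2 * r)| := by
        gcongr ?_ * ?_
        exact setIntegral_mono_set (integrableOn_abs_sub_const hb x _ _)
          (Filter.Eventually.of_forall fun y => abs_nonneg _)
          (ball_subset_ball (by linarith)).eventuallyLE
    _ = _ := by
        rw [volume_ball_two_mul_toReal]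
        field_simp

/-- The infimum defining `‖b‖_θ` is attained. -/
theorem bmoLBound_bmoLNorm {n : ℕ} {ρ b : Eucl n → ℝ} {θ : ℝ} (hρ : ∀ x, 0 ≤ ρ x)
    (hb : MemBMOL ρ b θ) : BMOLBound ρ b θ (bmoLNorm ρ b θ) := by
  intro x r hr
  have hP : 0 < (1 + r / ρ x) ^ θ := by
    have := div_nonneg hr.le (hρ x)
    positivity
  rw [← div_le_iff₀ hP]
  exact le_csInf hb.2 fun C hC => (div_le_iff₀ hP).2 (hC.2 x r hr)

theorem bmoLNorm_nonneg {n : ℕ} (ρ b : Eucl n → ℝ) (θ : ℝ) : 0 ≤ bmoLNorm ρ b θ :=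
  Real.sInf_nonneg fun _ hC => hC.1

/-- Telescoping bound for averages over dyadic dilates, given a common bound for the mean
oscillations. -/
theorem abs_ballAvg_pow_sub_le {n : ℕ} {b : Eucl n → ℝ} (hb : LocallyIntegrable b volume)
    (x : Eucl n) {r : ℝ} (hr : 0 < r) {M : ℝ} (k : ℕ)
    (hM : ∀ j ≤ k, (volume (ball x (2 ^ j * r))).toReal⁻¹ *
      (∫ y in ball x (2 ^ j * r), |b y - ballAvg b x (2 ^ j * r)|) ≤ M) :
    |ballAvg b x (2 ^ k * r) - ballAvg b x r| ≤ k * (2 ^ n * M) := by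
  induction k with
  | zero => simp
  | succ k ih =>
    have hstep := abs_ballAvg_two_mul_sub_le hb x (r := 2 ^ k * r) (by positivity)
    have hosc := hM (k + 1) le_rfl
    rw [pow_succ', mul_assoc] at hosc ⊢
    have hprev := ih fun j hj => hM j (hj.trans k.le_succ)
    have htri := abs_sub_le (ballAvg b x (2 * (2 ^ k * r))) (ballAvg b x (2 ^ k * r))
      (ballAvg b x r)
    have hmul := mul_le_mul_of_nonneg_left hosc (show (0 : ℝ) ≤ 2 ^ n by positivity)
    push_cast
    linarith

end SchrodingerCommutators

/-- For `b ∈ BMO_L^θ` and `θ' = (N₀+1)θ`, for every ball `B = B(x₀,r)` and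
integer `k ≥ 1`: `(1/|2^k B|)∫_{2^k B} |b - b_B| ≤ C ‖b‖_θ k (1 + 2^k r/ρ(x₀))^{θ'}`. -/
theorem bmoL_dilated_ball_bound {n : ℕ} (hn : 3 ≤ n) (V : Eucl n → ℝ)
    (hV : IsRH V ((n : ℝ) / 2))
    (c₀ N₀ : ℝ) (hc₀ : 0 < c₀) (hN₀ : 1 ≤ N₀)
    (hcomp : ∀ x y : Eucl n,
      c₀⁻¹ * critRad V x * (1 + dist x y / critRad V x) ^ (-N₀) ≤ critRad V y ∧
      critRad V y ≤ c₀ * critRad V x * (1 + dist x y / critRad V x) ^ (N₀ / (N₀ + 1)))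
    (θ : ℝ) (hθ : 0 < θ)
    (b : Eucl n → ℝ) (hb : MemBMOL (critRad V) b θ) :
    ∃ C > (0 : ℝ), ∀ (x₀ : Eucl n) (r : ℝ), 0 < r → ∀ k : ℕ, 1 ≤ k →
      (volume (ball x₀ (2 ^ k * r))).toReal⁻¹ *
          (∫ y in ball x₀ (2 ^ k * r), |b y - ballAvg b x₀ r|)
        ≤ C * bmoLNorm (critRad V) b θ * (k : ℝ) *
            (1 + 2 ^ k * r / critRad V x₀) ^ ((N₀ + 1) * θ) := by
  have hρ := critRad_nonneg V
  refine ⟨1 + 2 ^ n, by positivity, fun x₀ r hr k hk => ?_⟩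
  set K := bmoLNorm (critRad V) b θ
  have hK : 0 ≤ K := bmoLNorm_nonneg _ _ _
  set P := (1 + 2 ^ k * r / critRad V x₀) ^ ((N₀ + 1) * θ)
  have hosc : ∀ j ≤ k, (volume (ball x₀ (2 ^ j * r))).toReal⁻¹ *
      (∫ y in ball x₀ (2 ^ j * r), |b y - ballAvg b x₀ (2 ^ j * r)|) ≤ K * P := by
    intro j hj
    refine (bmoLBound_bmoLNorm hρ hb x₀ (2 ^ j * r) (by positivity)).trans ?_
    have hρ₀ := hρ x₀
    have hle : 2 ^ j * r / critRad V x₀ ≤ 2 ^ k * r / critRad V x₀ := by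
      gcongr
      norm_num
    have hone : 1 ≤ 1 + 2 ^ k * r / critRad V x₀ := le_add_of_nonneg_right (by positivity)
    refine mul_le_mul_of_nonneg_left ?_ hK
    calc _ ≤ (1 + 2 ^ k * r / critRad V x₀) ^ θ :=
          Real.rpow_le_rpow (by positivity) (by linarith) hθ.le
      _ ≤ P := Real.rpow_le_rpow_of_exponent_le hone (by nlinarith)
  have hP : 0 ≤ P := by
    have := hρ x₀
    positivity
  have hk' : (1 : ℝ) ≤ k := by exact_mod_cast hk
  calc _ ≤ _ := ballAvg_abs_sub_le hb.1 x₀ (by positivity) (ballAvg b x₀ (2 ^ k * r)) _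
    _ ≤ K * P + k * (2 ^ n * (K * P)) :=
        add_le_add (hosc k le_rfl) (abs_ballAvg_pow_sub_le hb.1 x₀ hr k hosc)
    _ ≤ k * (K * P) + k * (2 ^ n * (K * P)) := by
        have := le_mul_of_one_le_left (mul_nonneg hK hP) hk'
        gcongr
    _ = _ := by ring
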